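/- arXiv:1803.05361 — 2 statements merged into one kernel-verified Lean document; each statement's English description precedes it below -/
import Mathlib

section
/- Fix an integer q ≥ 1 and reals α_1,…,α_q > 1 with α_max = max_j α_j. Let E be a finite set; for each e ∈ E let σ_e ≥ 0 and ξ_{e,j} > 0 (j = 1,…,q), and define F_e(l) = 0 for l = 0 and F_e(l) = σ_e + Σ_j ξ_{e,j}·l^{α_j} for l > 0. Let N ≥ 1 be an integer, let each player i ∈ {1,…,N} have a weight function w_i : E → ℝ with w_i(e) ≥ 1 and a nonempty strategy set P_i of finite subsets of E, and for a profile p ∈ P_1 × ⋯ × P_N let l_e^p = Σ_{i : e ∈ p_i} w_i(e) and C(p) = Σ_e F_e(l_e^p). For each j fix an integer K_j ≥ 1 and reals z_{k,j} ≥ 0, x_{k,j} ∈ [0, α_j − 1], y_{k,j} ∈ [1, α_j] with x_{k,j} + y_{k,j} = α_j (k = 1,…,K_j); let z ≥ 1 with z ≥ z_{k,j} for all k, j and λ_α = max_j (2K_j z)^{α_max + 1}, and let γ be a real with γ ≥ min_j ((1/(α_j − 1))·σ_e/ξ_{e,j})^{1/α_j} for every e ∈ E. Suppose cost shares f_{i,e}(p)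 ≥ 0 are given for every profile p, player i and resource e, satisfying: f_{i,e}(p) = 0 if e ∉ p_i; f_{i,e}(p) ≤ σ_e + Σ_j ξ_{e,j} Σ_k z_{k,j}·(l_e^p − w_i(e))^{x_{k,j}}·(w_i(e))^{y_{k,j}} if e ∈ p_i; and Σ_{i=1}^N f_{i,e}(p) = F_e(l_e^p) for every e and p (budget balance). Set C_i(p) = Σ_e f_{i,e}(p). If p ∈ P_1 × ⋯ × P_N is a pure Nash equilibrium, i.e., C_i(p) ≤ C_i(q_i, p_{−i}) for every i and every q_i ∈ P_i, then C(p) ≤ 2(γ + λ_α)·C(p̂) for every profile p̂ ∈ P_1 × ⋯ × P_N. -/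
/-- The load `l_e^p = Σ_{i : e ∈ p_i} w_i(e)` induced on resource `e` by the
strategy profile `p`. -/
noncomputable def load {E : Type*} [Fintype E] [DecidableEq E] {N : ℕ}
    (w : Fin N → E → ℝ) (p : Fin N → Finset E) (e : E) : ℝ :=
  ∑ i : Fin N, if e ∈ p i then w i e else 0

/-- An REP cost function: `F(0) = 0` and `F(l) = σ + Σ_j ξ_j·l^{α_j}` for `l ≠ 0`. -/
noncomputable def REPcost {q : ℕ} (α : Fin q → ℝ) (σc : ℝ) (ξ : Fin q → ℝ)
    (l : ℝ) : ℝ :=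
  if l = 0 then 0 else σc + ∑ j, ξ j * l ^ α j

theorem sum_rpow_le_rpow_sum {ι : Type*} (s : Finset ι) (a : ι → ℝ) (ha : ∀ i ∈ s, 0 ≤ a i)
    {y : ℝ} (hy : 1 ≤ y) : ∑ i ∈ s, a i ^ y ≤ (∑ i ∈ s, a i) ^ y := by
  have hsplit : ∀ {t : ℝ}, 0 ≤ t → t ^ y = t * t ^ (y - 1) := fun ht => by
    conv_lhs => rw [← add_sub_cancel 1 y]
    rw [Real.rpow_add_of_nonneg ht zero_le_one (by linarith), Real.rpow_one]
  rw [hsplit (Finset.sum_nonneg ha), Finset.sum_mul]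
  refine Finset.sum_le_sum fun i hi => ?_
  rw [hsplit (ha i hi)]
  exact mul_le_mul_of_nonneg_left
    (Real.rpow_le_rpow (ha i hi) (Finset.single_le_sum ha hi) (by linarith)) (ha i hi)

/-- A Young-type inequality for mixed monomials. -/
theorem rpow_mul_rpow_le_div_add {L l m x y : ℝ} (hL : 0 ≤ L) (hl : 0 ≤ l) (hm : 1 ≤ m)
    (hx : 0 ≤ x) (hy : 1 ≤ y) :
    L ^ x * l ^ y ≤ L ^ (x + y) / m + m ^ x * l ^ (x + y) := by
  have hm0 : 0 < m := by linarith
  have hy0 : 0 ≤ y := by linarith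
  rw [Real.rpow_add_of_nonneg hL hx hy0, Real.rpow_add_of_nonneg hl hx hy0]
  have hLx := Real.rpow_nonneg hL x
  have hly := Real.rpow_nonneg hl y
  have hlx := Real.rpow_nonneg hl x
  have hLy := Real.rpow_nonneg hL y
  have hmx := Real.rpow_nonneg hm0.le x
  rcases le_total L (m * l) with h | h
  · have h1 : L ^ x ≤ m ^ x * l ^ x := by
      rw [← Real.mul_rpow hm0.le hl]
      exact Real.rpow_le_rpow hL h hx
    calc L ^ x * l ^ y ≤ m ^ x * l ^ x * l ^ y := mul_le_mul_of_nonneg_right h1 hly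
      _ = m ^ x * (l ^ x * l ^ y) := by ring
      _ ≤ _ := le_add_of_nonneg_left (by positivity)
  · have h1 : m * l ^ y ≤ L ^ y := by
      calc m * l ^ y ≤ m ^ y * l ^ y :=
            mul_le_mul_of_nonneg_right (Real.self_le_rpow_of_one_le hm hy) hly
        _ = (m * l) ^ y := (Real.mul_rpow hm0.le hl).symm
        _ ≤ L ^ y := Real.rpow_le_rpow (by positivity) h hy0
    have h2 : l ^ y ≤ L ^ y / m := by
      rw [le_div_iff₀ hm0]
      linarith
    calc L ^ x * l ^ y ≤ L ^ x * (L ^ y / m) := mul_le_mul_of_nonneg_left h2 hLx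
      _ = L ^ x * L ^ y / m := by ring
      _ ≤ _ := le_add_of_nonneg_right (by positivity)

/-- The startup cost, charged once per unit of load, is at most `γ` times the total cost. -/
theorem mul_startup_le {a s c l γ : ℝ} (ha : 1 < a) (hs : 0 ≤ s) (hc : 0 < c) (hl : 0 ≤ l)
    (hγ : (1 / (a - 1) * (s / c)) ^ (1 / a) ≤ γ) : l * s ≤ γ * (s + c * l ^ a) := by
  have ha1 : 0 < a - 1 := by linarith
  set g := (1 / (a - 1) * (s / c)) ^ (1 / a) with hg
  have hg0 : 0 ≤ g := by positivity
  have hla : 0 ≤ l ^ a := Real.rpow_nonneg hl a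
  have hga : g ^ a = 1 / (a - 1) * (s / c) := by
    rw [hg, ← Real.rpow_mul (by positivity), one_div_mul_cancel (by linarith), Real.rpow_one]
  have hsg : s = (a - 1) * c * g ^ a := by
    rw [hga]
    field_simp
  refine le_trans ?_ (mul_le_mul_of_nonneg_right hγ (by positivity))
  rcases hg0.eq_or_lt with h | h
  · rw [← h, Real.zero_rpow (by linarith)] at hsg
    simp [hsg, ← h]
  · have hb := one_add_mul_self_le_rpow_one_add (s := l / g - 1)
      (by linarith [div_nonneg hl hg0]) ha.le
    rw [add_sub_cancel, Real.div_rpow hl hg0, le_div_iff₀ (Real.rpow_pos_of_pos h a)] at hb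
    have ht : l = l / g * g := by field_simp
    have ht0 : 0 ≤ l / g := by positivity
    have hgap : 0 < g ^ a := Real.rpow_pos_of_pos h a
    generalize l / g = t at hb ht ht0
    have key : t * ((a - 1) * g ^ a) ≤ (a - 1) * g ^ a + l ^ a := by nlinarith
    calc l * s = g * c * (t * ((a - 1) * g ^ a)) := by rw [hsg, ht]; ring
      _ ≤ g * c * ((a - 1) * g ^ a + l ^ a) := mul_le_mul_of_nonneg_left key (by positivity)
      _ = g * (s + c * l ^ a) := by rw [hsg]; ring

theorem load_nonneg {E : Type*} [Fintype E] [DecidableEq E] {N : ℕ} {w : Fin N → E → ℝ}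
    (hw : ∀ i e, 0 ≤ w i e) (p : Fin N → Finset E) (e : E) : 0 ≤ load w p e :=
  Finset.sum_nonneg fun i _ => by split_ifs <;> simp [hw]

/-- The load of the other players after a deviation of player `i` is at most the old load. -/
theorem load_update_sub_mem_Icc {E : Type*} [Fintype E] [DecidableEq E] {N : ℕ}
    {w : Fin N → E → ℝ} (hw : ∀ i e, 0 ≤ w i e) (p : Fin N → Finset E) (i : Fin N)
    {A : Finset E} {e : E} (he : e ∈ A) :
    load w (Function.update p i A) e - w i e ∈ Set.Icc 0 (load w p e) := by
  have h1 : load w (Function.update p i A) e - w i e =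
      ∑ j ∈ Finset.univ.erase i, if e ∈ p j then w j e else 0 := by
    rw [load, ← Finset.add_sum_erase _ _ (Finset.mem_univ i), Function.update_self, if_pos he,
      add_sub_cancel_left]
    refine Finset.sum_congr rfl fun j hj => ?_
    rw [Function.update_of_ne (Finset.ne_of_mem_erase hj)]
  have h2 : ∀ j, 0 ≤ if e ∈ p j then w j e else 0 := fun j => by split_ifs <;> simp [hw]
  rw [h1]
  exact ⟨Finset.sum_nonneg fun j _ => h2 j,
    Finset.sum_le_sum_of_subset_of_nonneg (Finset.erase_subset _ _) fun j _ _ => h2 j⟩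

/-- The expanded terms belonging to one exponent are smooth. -/
theorem sum_expanded_le {κ : ℕ} (hκ : 1 ≤ κ) {a amax lam z L l : ℝ} {zc x y : Fin κ → ℝ}
    (ha : a ≤ amax) (hx : ∀ k, x k ∈ Set.Icc 0 (a - 1))
    (hy : ∀ k, 1 ≤ y k) (hxy : ∀ k, x k + y k = a) (hz : 1 ≤ z) (hzz : ∀ k, zc k ≤ z)
    (hlam : (2 * (κ : ℝ) * z) ^ (amax + 1) ≤ lam) (hL : 0 ≤ L) (hl : 0 ≤ l) :
    ∑ k, zc k * L ^ x k * l ^ y k ≤ 1 / 2 * L ^ a + lam * l ^ a := by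
  have hκ' : (1 : ℝ) ≤ κ := by exact_mod_cast hκ
  have hκ0 : (0 : ℝ) < κ := by linarith
  have hκz : 1 ≤ (κ : ℝ) * z := one_le_mul_of_one_le_of_one_le hκ' hz
  set m := 2 * (κ : ℝ) * z with hm
  have hm1 : 1 ≤ m := by linarith
  have hm0 : 0 < m := by linarith
  have hLa := Real.rpow_nonneg hL a
  have hla := Real.rpow_nonneg hl a
  have hterm : ∀ k, zc k * L ^ x k * l ^ y k ≤ (1 / 2 * L ^ a + lam * l ^ a) / κ := by
    intro k
    have h1 := rpow_mul_rpow_le_div_add hL hl hm1 (hx k).1 (hy k)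
    rw [hxy k] at h1
    have hmx : κ * z * m ^ x k ≤ lam := by
      calc κ * z * m ^ x k ≤ m * m ^ x k :=
            mul_le_mul_of_nonneg_right (by linarith) (by positivity)
        _ = m ^ (x k + 1) := by rw [Real.rpow_add_one hm0.ne', mul_comm]
        _ ≤ m ^ (amax + 1) := Real.rpow_le_rpow_of_exponent_le hm1 (by linarith [(hx k).2])
        _ ≤ lam := hlam
    rw [le_div_iff₀ hκ0]
    calc zc k * L ^ x k * l ^ y k * κ = zc k * (κ * (L ^ x k * l ^ y k)) := by ring
      _ ≤ z * (κ * (L ^ x k * l ^ y k)) := mul_le_mul_of_nonneg_right (hzz k) (by positivity)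
      _ ≤ z * (κ * (L ^ a / m + m ^ x k * l ^ a)) := by gcongr
      _ = 1 / 2 * L ^ a + κ * z * m ^ x k * l ^ a := by rw [hm]; field_simp
      _ ≤ _ := by gcongr
  calc ∑ k, zc k * L ^ x k * l ^ y k
      ≤ ∑ _k : Fin κ, (1 / 2 * L ^ a + lam * l ^ a) / κ := Finset.sum_le_sum fun k _ => hterm k
    _ = _ := by
      rw [Finset.sum_const, Finset.card_univ, Fintype.card_fin, nsmul_eq_mul]
      field_simp

theorem sum_le_REPcost {q : ℕ} {α ξ : Fin q → ℝ} {s l : ℝ} (hα : ∀ j, α j ≠ 0) (hs : 0 ≤ s) :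
    ∑ j, ξ j * l ^ α j ≤ REPcost α s ξ l := by
  rw [REPcost]
  split_ifs with h
  · simp [h, Real.zero_rpow (hα _)]
  · linarith

/-- pure-strategy instance of Theorem 10.1: in the GND game with REP
cost functions induced by a budget-balanced REP-expanded cost sharing mechanism
`f`, every pure Nash equilibrium `p` satisfies `C(p) ≤ 2(γ + λ_α)·C(p̂)` for every
feasible profile `p̂`. -/
theorem budget_balanced_rep_expanded_poa
    {q : ℕ} (hq : 1 ≤ q) (α : Fin q → ℝ) (hα : ∀ j, 1 < α j)
    (αmax : ℝ) (hmax₁ : ∀ j, α j ≤ αmax) (hmax₂ : ∃ j, αmax = α j)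
    {E : Type*} [Fintype E] [DecidableEq E]
    (σ : E → ℝ) (hσ : ∀ e, 0 ≤ σ e)
    (ξ : E → Fin q → ℝ) (hξ : ∀ e j, 0 < ξ e j)
    {N : ℕ} (hN : 1 ≤ N)
    (w : Fin N → E → ℝ) (hw : ∀ i e, 1 ≤ w i e)
    (P : Fin N → Set (Finset E)) (hP : ∀ i, (P i).Nonempty)
    (K : Fin q → ℕ) (hK : ∀ j, 1 ≤ K j)
    (zc : (j : Fin q) → Fin (K j) → ℝ) (hzc : ∀ j k, 0 ≤ zc j k)
    (x y : (j : Fin q) → Fin (K j) → ℝ)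
    (hx : ∀ j k, x j k ∈ Set.Icc 0 (α j - 1))
    (hy : ∀ j k, y j k ∈ Set.Icc 1 (α j))
    (hxy : ∀ j k, x j k + y j k = α j)
    (z : ℝ) (hz : 1 ≤ z) (hzz : ∀ j k, zc j k ≤ z)
    (lamα : ℝ)
    (hlam₁ : ∀ j, (2 * (K j : ℝ) * z) ^ (αmax + 1) ≤ lamα)
    (hlam₂ : ∃ j, lamα = (2 * (K j : ℝ) * z) ^ (αmax + 1))
    (γ : ℝ)
    (hγ : ∀ e, ∃ j, (1 / (α j - 1) * (σ e / ξ e j)) ^ (1 / α j) ≤ γ)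
    (f : Fin N → E → (Fin N → Finset E) → ℝ)
    (hf0 : ∀ i e p, 0 ≤ f i e p)
    (hf1 : ∀ i e (p : Fin N → Finset E), e ∉ p i → f i e p = 0)
    (hf2 : ∀ i e (p : Fin N → Finset E), e ∈ p i →
      f i e p ≤ σ e + ∑ j, ξ e j * ∑ k, zc j k *
        (load w p e - w i e) ^ x j k * w i e ^ y j k)
    (hbb : ∀ e (p : Fin N → Finset E),
      ∑ i, f i e p = REPcost α (σ e) (ξ e) (load w p e))
    (p : Fin N → Finset E) (hp : ∀ i, p i ∈ P i)
    (hNE : ∀ i, ∀ qi ∈ P i,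
      ∑ e, f i e p ≤ ∑ e, f i e (Function.update p i qi)) :
    ∀ phat : Fin N → Finset E, (∀ i, phat i ∈ P i) →
      (∑ e, REPcost α (σ e) (ξ e) (load w p e)) ≤
        2 * (γ + lamα) * ∑ e, REPcost α (σ e) (ξ e) (load w phat e) := by
  intro phat hphat
  have hw0 : ∀ i e, 0 ≤ w i e := fun i e => zero_le_one.trans (hw i e)
  have hα0 : ∀ j, α j ≠ 0 := fun j => by linarith [hα j]
  have hsmooth : ∀ e, ∑ i, f i e (Function.update p i (phat i)) ≤
      (γ + lamα) * REPcost α (σ e) (ξ e) (load w phat e) +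
        1 / 2 * REPcost α (σ e) (ξ e) (load w p e) := by
    intro e
    set L := load w p e with hLdef
    set l := load w phat e with hldef
    have hL : 0 ≤ L := load_nonneg hw0 p e
    have hl : 0 ≤ l := load_nonneg hw0 phat e
    set S := Finset.univ.filter fun i => e ∈ phat i with hS
    have hlS : l = ∑ i ∈ S, w i e := by rw [hldef, load, hS, Finset.sum_filter]
    have hcard : (S.card : ℝ) ≤ l := by
      rw [hlS, Finset.cast_card]
      exact Finset.sum_le_sum fun i _ => hw i e
    have hstartup : S.card * σ e ≤ γ * REPcost α (σ e) (ξ e) l := by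
      rcases eq_or_ne l 0 with h0 | h0
      · have : (S.card : ℝ) = 0 := le_antisymm (h0 ▸ hcard) (Nat.cast_nonneg _)
        simp [this, h0, REPcost]
      · obtain ⟨j, hj⟩ := hγ e
        have hγ0 : 0 ≤ γ := by
          refine le_trans (Real.rpow_nonneg (mul_nonneg ?_ ?_) _) hj
          · exact one_div_nonneg.2 (by linarith [hα j])
          · exact div_nonneg (hσ e) (hξ e j).le
        rw [REPcost, if_neg h0]
        calc S.card * σ e ≤ l * σ e := mul_le_mul_of_nonneg_right hcard (hσ e)
          _ ≤ γ * (σ e + ξ e j * l ^ α j) := mul_startup_le (hα j) (hσ e) (hξ e j) hl hj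
          _ ≤ γ * (σ e + ∑ j, ξ e j * l ^ α j) := by
            gcongr
            exact Finset.single_le_sum (f := fun j => ξ e j * l ^ α j)
              (fun j _ => mul_nonneg (hξ e j).le (Real.rpow_nonneg hl _)) (Finset.mem_univ j)
    have hlam0 : 0 ≤ lamα := by
      obtain ⟨j, hj⟩ := hlam₂
      rw [hj]
      positivity
    calc ∑ i, f i e (Function.update p i (phat i))
        = ∑ i ∈ S, f i e (Function.update p i (phat i)) := by
          rw [hS, Finset.sum_filter]
          refine Finset.sum_congr rfl fun i _ => ?_
          split_ifs with hi
          · rfl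
          · exact hf1 i e _ (by rwa [Function.update_self])
      _ ≤ ∑ i ∈ S, (σ e + ∑ j, ξ e j * ∑ k, zc j k * L ^ x j k * w i e ^ y j k) := by
          refine Finset.sum_le_sum fun i hi => ?_
          have he : e ∈ phat i := (Finset.mem_filter.1 hi).2
          have hload := load_update_sub_mem_Icc hw0 p i he
          refine (hf2 i e _ (by rwa [Function.update_self])).trans ?_
          gcongr with j _ k _
          · exact (hξ e j).le
          · exact Real.rpow_nonneg (hw0 i e) _
          · exact hzc j k
          · exact hload.1
          · exact (hx j k).1
          · exact hload.2
      _ = S.card * σ e +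
            ∑ j, ξ e j * ∑ k, zc j k * L ^ x j k * ∑ i ∈ S, w i e ^ y j k := by
          rw [Finset.sum_add_distrib, Finset.sum_const, nsmul_eq_mul, Finset.sum_comm]
          congr 1
          refine Finset.sum_congr rfl fun j _ => ?_
          rw [← Finset.mul_sum, Finset.sum_comm]
          simp only [Finset.mul_sum]
      _ ≤ S.card * σ e + ∑ j, ξ e j * ∑ k, zc j k * L ^ x j k * l ^ y j k := by
          gcongr with j _ k _
          · exact (hξ e j).le
          · exact mul_nonneg (hzc j k) (Real.rpow_nonneg hL _)
          · rw [hlS]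
            exact sum_rpow_le_rpow_sum S _ (fun i _ => hw0 i e) (hy j k).1
      _ ≤ S.card * σ e + ∑ j, ξ e j * (1 / 2 * L ^ α j + lamα * l ^ α j) := by
          gcongr with j _
          · exact (hξ e j).le
          · exact sum_expanded_le (hK j) (hmax₁ j) (hx j) (fun k => (hy j k).1) (hxy j) hz
              (hzz j) (hlam₁ j) hL hl
      _ = S.card * σ e + lamα * ∑ j, ξ e j * l ^ α j + 1 / 2 * ∑ j, ξ e j * L ^ α j := by
          rw [Finset.mul_sum, Finset.mul_sum, add_assoc, ← Finset.sum_add_distrib]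
          congr 1
          exact Finset.sum_congr rfl fun j _ => by ring
      _ ≤ γ * REPcost α (σ e) (ξ e) l + lamα * REPcost α (σ e) (ξ e) l +
            1 / 2 * REPcost α (σ e) (ξ e) L := by
          gcongr <;> exact sum_le_REPcost hα0 (hσ e)
      _ = _ := by ring
  have hcost : ∑ e, REPcost α (σ e) (ξ e) (load w p e) ≤
      (γ + lamα) * ∑ e, REPcost α (σ e) (ξ e) (load w phat e) +
        1 / 2 * ∑ e, REPcost α (σ e) (ξ e) (load w p e) := by
    calc ∑ e, REPcost α (σ e) (ξ e) (load w p e) = ∑ i, ∑ e, f i e p := by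
          rw [Finset.sum_comm]
          exact Finset.sum_congr rfl fun e _ => (hbb e p).symm
      _ ≤ ∑ i, ∑ e, f i e (Function.update p i (phat i)) :=
          Finset.sum_le_sum fun i _ => hNE i _ (hphat i)
      _ = ∑ e, ∑ i, f i e (Function.update p i (phat i)) := Finset.sum_comm
      _ ≤ _ := Finset.sum_le_sum fun e _ => hsmooth e
      _ = _ := by rw [Finset.sum_add_distrib, Finset.mul_sum, Finset.mul_sum]
  linarith
end

section
/- Let S be a nonempty finite set of players with weights w_i ≥ 1 (reals), let σ ≥ 0, q ≥ 1 an integer, α_1,…,α_q > 1 reals and ξ_1,…,ξ_q ≥ 0 reals. Define h(x) = Σ_{j=1}^q ξ_j·x^{α_j} for x ≥ 0, and F(l) = σ + h(l) for l > 0, F(0) = 0. For a nonempty finite set X of players and i ∈ X, let f_i(X) denote the Shapley cost share of i in X with respect to F. Let ψ be any linear ordering of S and for i ∈ S let S^i(ψ) = {i' ∈ S : i' precedes i in ψ}. Then Σ_{i ∈ S} f_i(S^i(ψ) ∪ {i}) = Σ_{k=1}^{|S|} ( σ/k + Σ_{T ⊆ S, |T| = k} h(Σ_{i ∈ T} w_i)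 / (binom(|S|, k)·k) ). -/
/-- The Shapley cost share of player `i` in the finite set `X` of players with weights
`w`, with respect to the cost function `F` on loads:
`f_i(X) = (1/|X|!)·Σ_π [F(W_π(i) + w_i) − F(W_π(i))]`, where `π` ranges over all
`|X|!` linear orderings of `X` (encoded as equivalences `Fin |X| ≃ X`) and `W_π(i)`
is the total weight of the players preceding `i` in `π`.  By convention the share is
`0` when `i ∉ X`. -/
noncomputable def shapleyShare {ι : Type*} [DecidableEq ι] (w : ι → ℝ) (F : ℝ → ℝ)
    (X : Finset ι) (i : ι) : ℝ :=
  if hi : i ∈ X then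
    (Nat.factorial X.card : ℝ)⁻¹ *
      ∑ π : Fin X.card ≃ {x : ι // x ∈ X},
        (F ((∑ i' : {x : ι // x ∈ X},
              if π.symm i' < π.symm ⟨i, hi⟩ then w i'.1 else 0) + w i) -
          F (∑ i' : {x : ι // x ∈ X},
              if π.symm i' < π.symm ⟨i, hi⟩ then w i'.1 else 0))
  else 0

open Finset

section Orderings

variable {V : Type*} [Fintype V]

theorem Numbering.card_filter_lt (f : Numbering V) (i : V) :
    #{x | f x < f i} = (f i : ℕ) := by
  rw [← Fin.card_Iio (f i), ← card_map f.symm.toEmbedding]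
  congr 1
  ext x
  simp [mem_map_equiv]

theorem Numbering.isPrefix_iff_filter_lt_eq (f : Numbering V) (A : Finset V) (j : V) :
    (f.IsPrefix A ∧ (f j : ℕ) = #A) ↔ ({x | f x < f j} : Finset V) = A := by
  constructor
  · rintro ⟨h, hj⟩
    ext x
    simp [h x, Fin.lt_def, hj]
  · intro h
    have hj : (f j : ℕ) = #A := by rw [← h, f.card_filter_lt]
    refine ⟨fun x => ?_, hj⟩
    rw [← hj, ← h, mem_filter, ← Fin.lt_def]
    simp

variable [DecidableEq V]

/-- The number of numberings in which exactly the elements of `A` precede `i`. -/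
theorem Numbering.card_filter_lt_eq {A : Finset V} {i : V} (hi : i ∉ A) :
    #{f : Numbering V | ({x | f x < f i} : Finset V) = A} =
      (#A).factorial * (Fintype.card V - 1 - #A).factorial := by
  have hA : #A < Fintype.card V := card_lt_univ_of_notMem hi
  have symm_count : ∀ j ∈ Aᶜ,
      #{f : Numbering V | ({x | f x < f j} : Finset V) = A} =
        #{f : Numbering V | ({x | f x < f i} : Finset V) = A} := by
    intro j hj
    rw [mem_compl] at hj
    have hswap : ∀ x, Equiv.swap i j x ∈ A ↔ x ∈ A := by
      intro x
      rw [Equiv.swap_apply_def]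
      split_ifs <;> simp_all
    refine card_equiv ((Equiv.swap i j).equivCongr (Equiv.refl _)) fun f => ?_
    simp only [mem_filter, mem_univ, true_and, Finset.ext_iff, Equiv.equivCongr_apply_apply,
      Equiv.symm_swap, Equiv.swap_apply_left, Equiv.refl_apply]
    constructor
    · intro h x
      rw [h, hswap]
    · intro h x
      rw [← hswap, ← h, Equiv.swap_apply_self]
  have hcount : #(Numbering.prefixed A) =
      ∑ j ∈ Aᶜ, #{f : Numbering V | ({x | f x < f j} : Finset V) = A} := by
    rw [card_eq_sum_card_fiberwise (f := fun f : Numbering V => f.symm ⟨#A, hA⟩) (t := Aᶜ)]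
    · refine sum_congr rfl fun j _ => congrArg card ?_
      ext f
      rw [mem_filter, mem_filter, Numbering.mem_prefixed,
        ← Numbering.isPrefix_iff_filter_lt_eq, Equiv.symm_apply_eq, Fin.ext_iff]
      simp [eq_comm]
    · intro f hf
      rw [mem_coe, Numbering.mem_prefixed] at hf
      simp [hf _]
  rw [sum_congr rfl symm_count, sum_const, card_compl, smul_eq_mul,
    Numbering.card_prefixed] at hcount
  obtain ⟨m, hm⟩ : ∃ m, Fintype.card V = #A + m + 1 := ⟨Fintype.card V - #A - 1, by omega⟩
  rw [show Fintype.card V - #A = m + 1 by omega, Nat.factorial_succ] at hcount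
  rw [show Fintype.card V - 1 - #A = m by omega]
  refine Nat.eq_of_mul_eq_mul_left (Nat.succ_pos m) ?_
  rw [Nat.succ_eq_add_one, ← hcount]
  ring

theorem sum_orderings_apply_preceding {n : ℕ} (hn : n = Fintype.card V) (i : V)
    (g : Finset V → ℝ) :
    ∑ π : Fin n ≃ V, g {x | π.symm x < π.symm i} =
      ∑ A ∈ (univ.erase i).powerset,
        ((#A).factorial * (n - 1 - #A).factorial : ℝ) * g A := by
  subst hn
  have hsymm : ∑ π : Fin (Fintype.card V) ≃ V, g {x | π.symm x < π.symm i} =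
      ∑ f : Numbering V, g {x | f x < f i} :=
    Equiv.sum_comp (Equiv.symmEquiv (Fin (Fintype.card V)) V)
      (fun f : Numbering V => g {x | f x < f i})
  rw [hsymm, ← sum_fiberwise_of_maps_to' (s := univ) (t := (univ.erase i).powerset)
    (g := fun f : Numbering V => ({x | f x < f i} : Finset V)) (f := g)]
  · refine sum_congr rfl fun A hA => ?_
    have hi : i ∉ A := fun h => by simpa using mem_powerset.1 hA h
    rw [sum_const, Numbering.card_filter_lt_eq hi, nsmul_eq_mul]
    push_cast
    rfl
  · intro f _
    rw [mem_powerset]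
    intro x hx
    simp only [mem_filter, mem_univ, true_and] at hx
    simp only [mem_erase, mem_univ, and_true]
    rintro rfl
    exact lt_irrefl _ hx

end Orderings

section ShapleyPotential

variable {ι : Type*}

/-- The Hart–Mas-Colell potential of the cost game `A ↦ F (∑ x ∈ A, w x)`. -/
noncomputable def shapleyPotential (w : ι → ℝ) (F : ℝ → ℝ) (X : Finset ι) : ℝ :=
  ∑ A ∈ X.powerset,
    ((#A - 1).factorial * (#X - #A).factorial / (#X).factorial : ℝ) * F (∑ x ∈ A, w x)

theorem shapleyPotential_empty (w : ι → ℝ) {F : ℝ → ℝ} (hF : F 0 = 0) :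
    shapleyPotential w F ∅ = 0 := by
  simp [shapleyPotential, hF]

theorem shapleyPotential_eq_sum_powersetCard (w : ι → ℝ) {F : ℝ → ℝ} (hF : F 0 = 0)
    (S : Finset ι) :
    shapleyPotential w F S =
      ∑ k ∈ Icc 1 #S, ∑ T ∈ S.powersetCard k,
        F (∑ i ∈ T, w i) / (((#S).choose k : ℝ) * (k : ℝ)) := by
  rw [shapleyPotential, sum_powerset, range_eq_Ico, sum_eq_sum_Ico_succ_bot (Nat.succ_pos _)]
  simp only [powersetCard_zero, sum_singleton, sum_empty, hF, mul_zero, zero_add]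
  refine sum_congr (by ext; simp) fun k hk => sum_congr rfl fun T hT => ?_
  obtain ⟨hk1, hkS⟩ := mem_Icc.1 hk
  rw [(mem_powersetCard.1 hT).2, Nat.cast_choose ℝ hkS,
    ← Nat.mul_factorial_pred (Nat.one_le_iff_ne_zero.1 hk1)]
  have hk0 : (k : ℝ) ≠ 0 := by positivity
  push_cast
  field_simp

variable [DecidableEq ι]

theorem shapleyShare_insert (w : ι → ℝ) (F : ℝ → ℝ) {Y : Finset ι} {i : ι} (hi : i ∉ Y) :
    shapleyShare w F (insert i Y) i =
      ∑ A ∈ Y.powerset,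
        ((#A).factorial * (#Y - #A).factorial / (#Y + 1).factorial : ℝ) *
          (F (∑ x ∈ insert i A, w x) - F (∑ x ∈ A, w x)) := by
  have hiX : i ∈ insert i Y := mem_insert_self i Y
  rw [shapleyShare, dif_pos hiX]
  simp only [← sum_filter]
  rw [sum_orderings_apply_preceding (Fintype.card_coe _).symm ⟨i, hiX⟩
    (fun A => F (∑ x ∈ A, w x.1 + w i) - F (∑ x ∈ A, w x.1)), mul_sum]
  rw [card_insert_of_notMem hi]
  refine sum_bij' (fun A _ => A.map (Function.Embedding.subtype _))
    (fun B _ => B.subtype (· ∈ insert i Y)) ?_ ?_ ?_ ?_ ?_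
  · intro A hA
    rw [mem_powerset] at hA ⊢
    intro x hx
    obtain ⟨y, hy, rfl⟩ := mem_map.1 hx
    have hne : y ≠ ⟨i, hiX⟩ := (mem_erase.1 (hA hy)).1
    exact (mem_insert.1 y.2).resolve_left fun h => hne (Subtype.ext h)
  · intro B hB
    rw [mem_powerset] at hB ⊢
    intro x hx
    rw [mem_subtype] at hx
    refine mem_erase.2 ⟨?_, mem_univ _⟩
    rintro rfl
    exact hi (hB hx)
  · intro A _
    ext x
    simp
  · intro B hB
    rw [mem_powerset] at hB
    exact subtype_map_of_mem fun x hx => mem_insert_of_mem (hB hx)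
  · intro A hA
    have hiA : i ∉ A.map (Function.Embedding.subtype (· ∈ insert i Y)) := by
      intro h
      obtain ⟨y, hy, hyi⟩ := mem_map.1 h
      exact (mem_erase.1 (mem_powerset.1 hA hy)).1 (Subtype.ext hyi)
    rw [sum_insert hiA, card_map, sum_map, Nat.add_sub_cancel, add_comm (w i)]
    simp only [Function.Embedding.subtype_apply]
    ring

theorem shapleyShare_insert_eq_sub (w : ι → ℝ) {F : ℝ → ℝ} (hF : F 0 = 0)
    {Y : Finset ι} {i : ι} (hi : i ∉ Y) :
    shapleyShare w F (insert i Y) i =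
      shapleyPotential w F (insert i Y) - shapleyPotential w F Y := by
  rw [shapleyShare_insert w F hi, shapleyPotential, shapleyPotential, sum_powerset_insert hi,
    add_sub_right_comm, ← sum_sub_distrib, ← sum_add_distrib]
  refine sum_congr rfl fun A hA => ?_
  rw [mem_powerset] at hA
  rw [card_insert_of_notMem hi, card_insert_of_notMem fun h => hi (hA h)]
  rcases A.eq_empty_or_nonempty with rfl | hne
  · simp [hF]
  obtain ⟨a, ha⟩ : ∃ a, #A = a + 1 := ⟨#A - 1, by have := hne.card_pos; omega⟩
  obtain ⟨m, hm⟩ : ∃ m, #Y = a + 1 + m :=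
    ⟨#Y - #A, by have := card_le_card hA; omega⟩
  rw [hm, ha, show a + 1 + m - (a + 1) = m by omega,
    show a + 1 + m + 1 - (a + 1) = m + 1 by omega,
    show a + 1 + m + 1 - (a + 1 + 1) = m by omega, Nat.add_sub_cancel, Nat.add_sub_cancel,
    Nat.factorial_succ a, Nat.factorial_succ m, Nat.factorial_succ (a + 1 + m)]
  have h1 : ((a + 1 + m).factorial : ℝ) ≠ 0 := by positivity
  have h2 : (a : ℝ) + 1 + m + 1 ≠ 0 := by positivity
  push_cast
  field_simp
  ring

theorem sum_shapleyShare_eq_shapleyPotential (w : ι → ℝ) {F : ℝ → ℝ} (hF : F 0 = 0)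
    (S : Finset ι) (ψ : Fin S.card ≃ {x : ι // x ∈ S}) :
    ∑ i : {x : ι // x ∈ S},
        shapleyShare w F
          (insert i.1
            ((S.attach.filter fun i' => ψ.symm i' < ψ.symm i).image Subtype.val))
          i.1 = shapleyPotential w F S := by
  let pre : ℕ → Finset ι := fun k =>
    (S.attach.filter fun i' => (ψ.symm i' : ℕ) < k).image Subtype.val
  have hpre : ∀ k : Fin S.card, pre (k + 1) = insert (ψ k).1 (pre k) := by
    intro k
    have : (S.attach.filter fun i' => (ψ.symm i' : ℕ) < k + 1) =
        insert (ψ k) (S.attach.filter fun i' => (ψ.symm i' : ℕ) < k) := by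
      ext x
      rw [mem_insert, mem_filter, mem_filter, ← Equiv.symm_apply_eq, Fin.ext_iff]
      simp only [mem_attach, true_and]
      omega
    simp only [pre, this, image_insert]
  have hnot : ∀ k : Fin S.card, (ψ k).1 ∉ pre k := by
    intro k hk
    obtain ⟨x, hx, hxk⟩ := mem_image.1 hk
    obtain rfl := Subtype.ext hxk
    simp at hx
  calc
    _ = ∑ k : Fin S.card,
        (shapleyPotential w F (pre (k + 1)) - shapleyPotential w F (pre k)) := by
      rw [← Equiv.sum_comp ψ]
      refine sum_congr rfl fun k _ => ?_
      rw [hpre k, ← shapleyShare_insert_eq_sub w hF (hnot k)]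
      simp only [pre, Equiv.symm_apply_apply, Fin.lt_def]
    _ = shapleyPotential w F (pre S.card) - shapleyPotential w F (pre 0) := by
      rw [Fin.sum_univ_eq_sum_range
        (fun k => shapleyPotential w F (pre (k + 1)) - shapleyPotential w F (pre k)),
        sum_range_sub (fun k => shapleyPotential w F (pre k))]
    _ = shapleyPotential w F S := by
      have h0 : pre 0 = ∅ := by simp [pre]
      have h1 : pre S.card = S := by simp [pre]
      rw [h0, h1, shapleyPotential_empty w hF, sub_zero]

end ShapleyPotential

/-- Lemma 8.1: the closed form of the potential function of the Shapley
cost sharing mechanism.  With `F(0) = 0`, `F(l) = σ + h(l)` for `l ≠ 0`,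
`h(x) = Σ_j ξ_j·x^{α_j}`, and any linear ordering `ψ` of `S` (encoded as an
equivalence `Fin |S| ≃ S`), writing `S^i(ψ)` for the set of players preceding `i`
in `ψ`,
`Σ_{i ∈ S} f_i(S^i(ψ) ∪ {i}) =
   Σ_{k=1}^{|S|} (σ/k + Σ_{T ⊆ S, |T| = k} h(Σ_{i ∈ T} w_i)/(binom(|S|,k)·k))`. -/
theorem shapley_potential_closed_form
    {ι : Type*} [DecidableEq ι] (S : Finset ι) (hS : S.Nonempty)
    (w : ι → ℝ) (hw : ∀ i ∈ S, 1 ≤ w i)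
    (σ : ℝ) (hσ : 0 ≤ σ)
    {q : ℕ} (hq : 1 ≤ q) (α : Fin q → ℝ) (hα : ∀ j, 1 < α j)
    (ξ : Fin q → ℝ) (hξ : ∀ j, 0 ≤ ξ j)
    (ψ : Fin S.card ≃ {x : ι // x ∈ S}) :
    ∑ i : {x : ι // x ∈ S},
        shapleyShare w (fun l => if l = 0 then 0 else σ + ∑ j, ξ j * l ^ α j)
          (insert i.1
            ((S.attach.filter fun i' => ψ.symm i' < ψ.symm i).image Subtype.val))
          i.1 =
      ∑ k ∈ Finset.Icc 1 S.card,
        (σ / (k : ℝ) +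
          ∑ T ∈ S.powersetCard k,
            (∑ j, ξ j * (∑ i ∈ T, w i) ^ α j) /
              ((S.card.choose k : ℝ) * (k : ℝ))) := by
  have hF : (fun l : ℝ => if l = 0 then 0 else σ + ∑ j, ξ j * l ^ α j) 0 = 0 := if_pos rfl
  rw [sum_shapleyShare_eq_shapleyPotential w hF S ψ,
    shapleyPotential_eq_sum_powersetCard w hF S]
  refine sum_congr rfl fun k hk => ?_
  obtain ⟨hk1, hkS⟩ := mem_Icc.1 hk
  have hterm : ∀ T ∈ S.powersetCard k,
      (if ∑ i ∈ T, w i = 0 then 0 else σ + ∑ j, ξ j * (∑ i ∈ T, w i) ^ α j) /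
          ((S.card.choose k : ℝ) * (k : ℝ)) =
        σ / ((S.card.choose k : ℝ) * (k : ℝ)) +
          (∑ j, ξ j * (∑ i ∈ T, w i) ^ α j) / ((S.card.choose k : ℝ) * (k : ℝ)) := by
    intro T hT
    obtain ⟨hTS, hTk⟩ := mem_powersetCard.1 hT
    have hpos : 0 < ∑ i ∈ T, w i :=
      sum_pos (fun i hi => zero_lt_one.trans_le (hw i (hTS hi))) (card_pos.1 (by omega))
    rw [if_neg hpos.ne', add_div]
  rw [sum_congr rfl hterm, sum_add_distrib, sum_const, card_powersetCard, nsmul_eq_mul]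
  congr 1
  have hc : (S.card.choose k : ℝ) ≠ 0 := by exact_mod_cast (Nat.choose_pos hkS).ne'
  field_simp
end
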